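/- Let S = k[x_1,…,x_n] be a positively Z-graded polynomial ring with maximal ideal m = (x_1,…,x_n), let A = k[x_1,…,x_j] (j < n) with maximal ideal n = (x_1,…,x_j), and let C be any A-module, with C_S the corresponding S-module. If gr_n(C) has a linear resolution over gr_n(A), then gr_m(C_S) has a linear resolution over gr_m(S). -/

import Mathlib

/-!
Background setup.  `MvPolynomial (Fin n) k` is the polynomial ring `S = k[x_1, …, x_n]`
over the field `k`, graded (possibly nonstandardly) by weights `w : Fin n → ℤ` with
`0 < w i`, with graded maximal ideal `m = maxIdeal k n = (x_1, …, x_n)`.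

* `trunc k n w e` is the truncation `S_{≥e} = ⊕_{i ≥ e} S_i`, an `S`-submodule of `S`
  (realized as the `S`-span of the weighted-homogeneous elements of weighted degree `≥ e`;
  for positive weights this span is exactly `⊕_{i ≥ e} S_i`).
* `GrRing k n` is the associated graded ring `gr_m(S) = ⊕_{i≥0} m^i/m^{i+1}`, realized
  as the quotient `Rees(m) ⧸ m·Rees(m)` of the Rees algebra of `m`; it is a standard
  graded polynomial ring over `k = S/m`.
* `GrMod k n M` is the associated graded module `gr_m(M) = ⊕_{i≥0} m^i M/m^{i+1} M` of an
  `S`-module `M`, realized as the quotient of the Rees module `⊕_i m^i M` by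
  `m·(⊕_i m^i M)`; it is a module over `gr_m(S) = GrRing k n`.
* `grDeg1 k n` is the degree-one component `m/m²` of `gr_m(S)`, i.e. the set of linear
  forms of the standard graded ring `gr_m(S)`.
* `HasLinearResolution R Lin N` says that `N` admits a free resolution
  `⋯ → F_{i+1} → F_i → ⋯ → F_0 → N → 0` in which every differential is given by a matrix
  all of whose entries lie in the set `Lin` of linear forms.  For a module generated in
  degree `0` over a standard graded `k`-algebra `R` (with `Lin = R_1`) this is the usual
  notion of a linear resolution: a graded free resolution `F_•` with `F_i` generated in
  degree `i`.
-/

set_option synthInstance.maxHeartbeats 1000000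
set_option maxHeartbeats 1000000

noncomputable section
open MvPolynomial

/-- The graded maximal ideal `m = (x_1, …, x_n)` of `S = k[x_1, …, x_n]`. -/
def maxIdeal (k : Type) [Field k] (n : ℕ) : Ideal (MvPolynomial (Fin n) k) :=
  Ideal.span (Set.range MvPolynomial.X)

/-- The truncation `S_{≥e} = ⊕_{i ≥ e} S_i` of the `ℤ`-graded polynomial ring `S` with
weights `w`. -/
def trunc (k : Type) [Field k] (n : ℕ) (w : Fin n → ℤ) (e : ℤ) :
    Submodule (MvPolynomial (Fin n) k) (MvPolynomial (Fin n) k) :=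
  Submodule.span _ (⋃ (d : ℤ) (_ : e ≤ d),
    (MvPolynomial.weightedHomogeneousSubmodule k w d : Set (MvPolynomial (Fin n) k)))

/-- The ideal `m·Rees(m)` of the Rees algebra `Rees(m)`; the quotient by it is `gr_m(S)`. -/
def grIdeal (k : Type) [Field k] (n : ℕ) : Ideal ↥(reesAlgebra (maxIdeal k n)) :=
  (maxIdeal k n).map (algebraMap (MvPolynomial (Fin n) k) ↥(reesAlgebra (maxIdeal k n)))

/-- The associated graded ring `gr_m(S) = ⊕_{i≥0} m^i/m^{i+1} = Rees(m)/m·Rees(m)`. -/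
abbrev GrRing (k : Type) [Field k] (n : ℕ) : Type :=
  ↥(reesAlgebra (maxIdeal k n)) ⧸ grIdeal k n

variable (k : Type) [Field k] (n : ℕ) (M : Type) [AddCommGroup M]
  [Module (MvPolynomial (Fin n) k) M]

/-- The Rees module `⊕_i m^i M` of an `S`-module `M`, a module over the Rees algebra. -/
def ReesMod : Type :=
  ↥(((maxIdeal k n).stableFiltration (⊤ : Submodule (MvPolynomial (Fin n) k) M)).submodule)

instance : AddCommGroup (ReesMod k n M) := by unfold ReesMod; infer_instance
instance : Module ↥(reesAlgebra (maxIdeal k n)) (ReesMod k n M) := by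
  unfold ReesMod; infer_instance

/-- The associated graded module `gr_m(M) = ⊕_{i≥0} m^i M/m^{i+1} M`, realized as the
quotient of the Rees module `⊕_i m^i M` by `m·(⊕_i m^i M)`; a `gr_m(S)`-module. -/
def GrMod : Type :=
  ReesMod k n M ⧸
    ((grIdeal k n) • (⊤ : Submodule ↥(reesAlgebra (maxIdeal k n)) (ReesMod k n M)))

instance : AddCommGroup (GrMod k n M) := by unfold GrMod; infer_instance
instance : Module (GrRing k n) (GrMod k n M) := by unfold GrMod; infer_instance

/-- The degree-one component `m/m²` of `gr_m(S)`: the set of (classes of) the degree-one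
elements `s·t` (`s ∈ m`) of the Rees algebra, i.e. the linear forms of `gr_m(S)`. -/
def grDeg1 : Set (GrRing k n) :=
  {g | ∃ s, ∃ hs : s ∈ maxIdeal k n, g = Ideal.Quotient.mk (grIdeal k n)
      ⟨Polynomial.monomial 1 s, reesAlgebra.monomial_mem.mpr (by simpa using hs)⟩}

/-- `N` has a **linear resolution** over `R` with respect to the set `Lin ⊆ R` of linear
forms (the degree-one component of the standard graded algebra `R`): there is a free
resolution `⋯ → F_{i+1} → F_i → ⋯ → F_0 → N → 0` in which every differential is given by
a matrix with all entries in `Lin`.  For `N` generated in degree `0` this is the usual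
notion of a linear resolution (`F_i` generated in degree `i`). -/
def HasLinearResolution (R : Type*) [CommRing R] (Lin : Set R)
    (N : Type*) [AddCommGroup N] [Module R N] : Prop :=
  ∃ (κ : ℕ → Type) (d : ∀ i : ℕ, (κ (i + 1) →₀ R) →ₗ[R] (κ i →₀ R))
    (ε : (κ 0 →₀ R) →ₗ[R] N),
      Function.Surjective ε ∧
      LinearMap.range (d 0) = LinearMap.ker ε ∧
      (∀ i, LinearMap.range (d (i + 1)) = LinearMap.ker (d i)) ∧
      (∀ i (a : κ (i + 1)) (b : κ i), d i (Finsupp.single a 1) b ∈ Lin)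

/-! ### Two polynomial rings: `A = k[x_1,…,x_j] ⊆ S = k[x_1,…,x_n]` (`j < n`) -/

/-- The surjection `π : S = k[x_1,…,x_n] → A = k[x_1,…,x_j]` fixing `x_1, …, x_j` and
sending `x_{j+1}, …, x_n` to `0`. -/
def projToA (k : Type) [Field k] (n j : ℕ) :
    MvPolynomial (Fin n) k →+* MvPolynomial (Fin j) k :=
  (MvPolynomial.aeval (fun i : Fin n =>
    if h : (i : ℕ) < j then (MvPolynomial.X ⟨i, h⟩ : MvPolynomial (Fin j) k)
    else 0)).toRingHom

theorem projToA_maxIdeal_le (k : Type) [Field k] (n j : ℕ) :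
    (maxIdeal k n).map (projToA k n j) ≤ maxIdeal k j := by
  rw [maxIdeal, Ideal.map_span, Ideal.span_le]
  rintro y ⟨x, ⟨i, rfl⟩, rfl⟩
  by_cases h : (i : ℕ) < j
  · simp only [projToA, AlgHom.toRingHom_eq_coe, RingHom.coe_coe, aeval_X, h, dif_pos]
    exact Ideal.subset_span ⟨⟨i, h⟩, rfl⟩
  · simp only [projToA, AlgHom.toRingHom_eq_coe, RingHom.coe_coe, aeval_X, h, dif_neg,
      not_false_iff]
    exact (maxIdeal k j).zero_mem

/-- The induced ring map `Rees(m) → Rees(n)` on Rees algebras, given by applying `π`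
to the coefficients. -/
def reesProj (k : Type) [Field k] (n j : ℕ) :
    ↥(reesAlgebra (maxIdeal k n)) →+* ↥(reesAlgebra (maxIdeal k j)) :=
  RingHom.codRestrict
    ((Polynomial.mapRingHom (projToA k n j)).comp
      (Subalgebra.val (reesAlgebra (maxIdeal k n))).toRingHom)
    (reesAlgebra (maxIdeal k j))
    (fun x => by
      rw [mem_reesAlgebra_iff]
      intro i
      simp only [RingHom.comp_apply, Polynomial.coe_mapRingHom, Polynomial.coeff_map]
      have h2 : ((maxIdeal k n) ^ i).map (projToA k n j) ≤ (maxIdeal k j) ^ i := by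
        rw [Ideal.map_pow]
        exact Ideal.pow_right_mono (projToA_maxIdeal_le k n j) i
      exact h2 (Ideal.mem_map_of_mem _ (x.2 i))
)

theorem reesProj_algebraMap (k : Type) [Field k] (n j : ℕ) (x : MvPolynomial (Fin n) k) :
    reesProj k n j (algebraMap (MvPolynomial (Fin n) k) ↥(reesAlgebra (maxIdeal k n)) x)
      = algebraMap (MvPolynomial (Fin j) k) ↥(reesAlgebra (maxIdeal k j))
          (projToA k n j x) := by
  apply Subtype.ext
  simp [reesProj, Polynomial.algebraMap_apply]

/-- The induced surjection `gr_m(S) → gr_n(A)` on associated graded rings. -/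
def grProj (k : Type) [Field k] (n j : ℕ) : GrRing k n →+* GrRing k j :=
  Ideal.quotientMap (grIdeal k j) (reesProj k n j) (by
    rw [grIdeal, Ideal.map_le_iff_le_comap]
    intro x hx
    rw [Ideal.mem_comap, Ideal.mem_comap, reesProj_algebraMap]
    exact Ideal.mem_map_of_mem _ (projToA_maxIdeal_le k n j (Ideal.mem_map_of_mem _ hx)))

/-- The inclusion `A = k[x_1,…,x_j] → S = k[x_1,…,x_n]`. -/
def inclA (k : Type) [Field k] (n j : ℕ) (h : j ≤ n) :
    MvPolynomial (Fin j) k →+* MvPolynomial (Fin n) k :=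
  (MvPolynomial.rename (Fin.castLE h)).toRingHom

theorem inclA_maxIdeal_le (k : Type) [Field k] (n j : ℕ) (h : j ≤ n) :
    (maxIdeal k j).map (inclA k n j h) ≤ maxIdeal k n := by
  rw [maxIdeal, Ideal.map_span, Ideal.span_le]
  rintro y ⟨x, ⟨i, rfl⟩, rfl⟩
  simp only [inclA, AlgHom.toRingHom_eq_coe, RingHom.coe_coe, rename_X]
  exact Ideal.subset_span ⟨Fin.castLE h i, rfl⟩

/-- The induced ring map `Rees(n) → Rees(m)` on Rees algebras. -/
def reesIncl (k : Type) [Field k] (n j : ℕ) (h : j ≤ n) :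
    ↥(reesAlgebra (maxIdeal k j)) →+* ↥(reesAlgebra (maxIdeal k n)) :=
  RingHom.codRestrict
    ((Polynomial.mapRingHom (inclA k n j h)).comp
      (Subalgebra.val (reesAlgebra (maxIdeal k j))).toRingHom)
    (reesAlgebra (maxIdeal k n))
    (fun x => by
      rw [mem_reesAlgebra_iff]
      intro i
      simp only [RingHom.comp_apply, Polynomial.coe_mapRingHom, Polynomial.coeff_map]
      have h2 : ((maxIdeal k j) ^ i).map (inclA k n j h) ≤ (maxIdeal k n) ^ i := by
        rw [Ideal.map_pow]
        exact Ideal.pow_right_mono (inclA_maxIdeal_le k n j h) i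
      exact h2 (Ideal.mem_map_of_mem _ (x.2 i)))

theorem reesIncl_algebraMap (k : Type) [Field k] (n j : ℕ) (h : j ≤ n)
    (x : MvPolynomial (Fin j) k) :
    reesIncl k n j h (algebraMap (MvPolynomial (Fin j) k) ↥(reesAlgebra (maxIdeal k j)) x)
      = algebraMap (MvPolynomial (Fin n) k) ↥(reesAlgebra (maxIdeal k n))
          (inclA k n j h x) := by
  apply Subtype.ext
  simp [reesIncl, Polynomial.algebraMap_apply]

/-- The induced ring map `gr_n(A) → gr_m(S)`, exhibiting `gr_m(S)` as a polynomial
extension of `gr_n(A)` in the (classes of the) variables `x_{j+1}, …, x_n`. -/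
def grIncl (k : Type) [Field k] (n j : ℕ) (h : j ≤ n) : GrRing k j →+* GrRing k n :=
  Ideal.quotientMap (grIdeal k n) (reesIncl k n j h) (by
    rw [grIdeal, Ideal.map_le_iff_le_comap]
    intro x hx
    rw [Ideal.mem_comap, Ideal.mem_comap, reesIncl_algebraMap]
    exact Ideal.mem_map_of_mem _ (inclA_maxIdeal_le k n j h (Ideal.mem_map_of_mem _ hx)))

/-- The class of the variable `x_l` in `gr_m(S)`. -/
def grVar (k : Type) [Field k] (n : ℕ) (l : Fin n) : GrRing k n :=
  Ideal.Quotient.mk (grIdeal k n)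
    ⟨Polynomial.monomial 1 (MvPolynomial.X l),
      reesAlgebra.monomial_mem.mpr (by
        rw [pow_one, maxIdeal]
        exact Ideal.subset_span (Set.mem_range_self l))⟩

section LinearResolution

variable {R R' : Type*} [CommRing R] [CommRing R'] (i : R →+* R') (p : R' →+* R)
  {α β γ : Type*}

/-- Apply a ring homomorphism to every coordinate of a vector. -/
def mapVec (i : R →+* R') (α : Type*) : (α →₀ R) →+ (α →₀ R') :=
  Finsupp.mapRange.addMonoidHom (i : R →+ R')

@[simp]
theorem mapVec_apply (v : α →₀ R) (a : α) : mapVec i α v a = i (v a) := by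
  simp [mapVec]

@[simp]
theorem mapVec_single (a : α) (r : R) :
    mapVec i α (Finsupp.single a r) = Finsupp.single a (i r) := by
  simp [mapVec]

/-- The matrix of `d`, with the ring homomorphism `i` applied to every entry. -/
def mapMatrix (i : R →+* R') (d : (α →₀ R) →ₗ[R] (β →₀ R)) : (α →₀ R') →ₗ[R'] (β →₀ R') :=
  Finsupp.linearCombination R' fun a =>
    mapVec i β (d (Finsupp.single a 1))

theorem mapVec_smul (r : R) (v : α →₀ R) : mapVec i α (r • v) = i r • mapVec i α v := by
  ext; simp

theorem mapMatrix_single (d : (α →₀ R) →ₗ[R] (β →₀ R)) (a : α) (r : R') :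
    mapMatrix i d (Finsupp.single a r) = r • mapVec i β (d (Finsupp.single a 1)) := by
  simp [mapMatrix]

theorem mapMatrix_mapVec (d : (α →₀ R) →ₗ[R] (β →₀ R)) (v : α →₀ R) :
    mapMatrix i d (mapVec i α v) = mapVec i β (d v) := by
  induction v using Finsupp.induction_linear with
  | zero => simp
  | add f g hf hg => simp only [map_add, hf, hg]
  | single a r =>
    have h : Finsupp.single a r = r • Finsupp.single a (1 : R) := by simp
    rw [h, mapVec_smul, map_smul, map_smul, mapVec_smul]
    simp [mapMatrix_single]

theorem mapVec_mapVec (h : ∀ r, p (i r) = r) (v : α →₀ R) :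
    mapVec p α (mapVec i α v) = v := by
  ext; simp [h]

theorem mapVec_mapMatrix (h : ∀ r, p (i r) = r) (d : (α →₀ R) →ₗ[R] (β →₀ R)) (v : α →₀ R') :
    mapVec p β (mapMatrix i d v) = d (mapVec p α v) := by
  induction v using Finsupp.induction_linear with
  | zero => simp
  | add f g hf hg => simp only [map_add, hf, hg]
  | single a r =>
    rw [mapMatrix_single, mapVec_smul, mapVec_mapVec i p h]
    have h : mapVec p α (Finsupp.single a r) = p r • Finsupp.single a (1 : R) := by simp
    rw [h, map_smul]

theorem mapMatrix_mapMatrix (d : (α →₀ R) →ₗ[R] (β →₀ R)) (d' : (β →₀ R) →ₗ[R] (γ →₀ R))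
    (h : ∀ v, d' (d v) = 0) (v : α →₀ R') : mapMatrix i d' (mapMatrix i d v) = 0 := by
  induction v using Finsupp.induction_linear with
  | zero => simp
  | add f g hf hg => simp only [map_add, hf, hg, add_zero]
  | single a r => rw [mapMatrix_single, map_smul, mapMatrix_mapVec, h, map_zero, smul_zero]

theorem HasLinearResolution.of_inverse {N N' : Type*} [AddCommGroup N] [Module R N]
    [AddCommGroup N'] [Module R' N'] {L : Set R} {L' : Set R'} (hpi : ∀ r, p (i r) = r)
    (hip : ∀ r, i (p r) = r) (f : N ≃+ N') (hf : ∀ (r : R) (x : N), f (r • x) = i r • f x)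
    (hL : ∀ r ∈ L, i r ∈ L')
    (H : HasLinearResolution R L N) : HasLinearResolution R' L' N' := by
  obtain ⟨κ, d, ε, hε, h0, hs, hd⟩ := H
  let ε' : (κ 0 →₀ R') →ₗ[R'] N' :=
    { toFun := fun v => f (ε (mapVec p _ v))
      map_add' := fun u v => by simp only [map_add]
      map_smul' := fun r v => by rw [mapVec_smul, map_smul, hf, hip]; simp }
  have hε' : ∀ v, ε' v = f (ε (mapVec p _ v)) := fun _ => rfl
  refine ⟨κ, fun l => mapMatrix i (d l), ε', ?_, ?_, ?_, ?_⟩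
  · intro x
    obtain ⟨v, hv⟩ := hε (f.symm x)
    refine ⟨mapVec i _ v, ?_⟩
    rw [hε', mapVec_mapVec i p hpi, hv, f.apply_symm_apply]
  · ext v
    constructor
    · rintro ⟨w, rfl⟩
      rw [LinearMap.mem_ker, hε', mapVec_mapMatrix i p hpi]
      have : d 0 (mapVec p _ w) ∈ LinearMap.ker ε := h0 ▸ ⟨_, rfl⟩
      rw [LinearMap.mem_ker.mp this, map_zero]
    · intro hv
      rw [LinearMap.mem_ker, hε', map_eq_zero_iff f f.injective, ← LinearMap.mem_ker, ← h0] at hv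
      obtain ⟨w, hw⟩ := hv
      refine ⟨mapVec i _ w, ?_⟩
      rw [mapMatrix_mapVec, hw, mapVec_mapVec p i hip]
  · intro l
    ext v
    constructor
    · rintro ⟨w, rfl⟩
      refine mapMatrix_mapMatrix _ _ _ (fun u => ?_) w
      have : d (l + 1) u ∈ LinearMap.ker (d l) := hs l ▸ ⟨_, rfl⟩
      exact this
    · intro hv
      have hv' : d l (mapVec p _ v) = 0 := by
        rw [← mapVec_mapMatrix i p hpi, LinearMap.mem_ker.mp hv, map_zero]
      rw [← LinearMap.mem_ker, ← hs] at hv'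
      obtain ⟨w, hw⟩ := hv'
      refine ⟨mapVec i _ w, ?_⟩
      rw [mapMatrix_mapVec, hw, mapVec_mapVec p i hip]
  · intro l a b
    rw [mapMatrix_single]
    simpa using hL _ (hd l a b)

/-- The index sets of the bases of the cone of multiplication by an element on a complex of free
modules with bases indexed by `κ`. -/
abbrev coneIndex (κ : ℕ → Type) : ℕ → Type
  | 0 => κ 0
  | i + 1 => κ (i + 1) ⊕ κ i

/-- The differentials of the cone of multiplication by `y` on the complex obtained from `d` by
applying `i` to all matrix entries. -/
def coneDiff (i : R →+* R') (y : R') {κ : ℕ → Type}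
    (d : ∀ l : ℕ, (κ (l + 1) →₀ R) →ₗ[R] (κ l →₀ R)) :
    ∀ l : ℕ, (coneIndex κ (l + 1) →₀ R') →ₗ[R'] (coneIndex κ l →₀ R')
  | 0 => ((mapMatrix i (d 0)).coprod (y • LinearMap.id)).comp
      (Finsupp.sumFinsuppLEquivProdFinsupp R').toLinearMap
  | l + 1 => (Finsupp.sumFinsuppLEquivProdFinsupp R').symm.toLinearMap.comp
      ((((mapMatrix i (d (l + 1))).coprod (y • LinearMap.id)).prod
        (-(mapMatrix i (d l)).comp (LinearMap.snd R' _ _))).comp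
        (Finsupp.sumFinsuppLEquivProdFinsupp R').toLinearMap)

theorem sumEquiv_single_inl (a : α) (r : R) :
    Finsupp.sumFinsuppLEquivProdFinsupp R (Finsupp.single (Sum.inl a : α ⊕ β) r) =
      (Finsupp.single a r, 0) := by
  classical
  ext b <;> simp [Finsupp.single_apply]

theorem sumEquiv_single_inr (b : β) (r : R) :
    Finsupp.sumFinsuppLEquivProdFinsupp R (Finsupp.single (Sum.inr b : α ⊕ β) r) =
      (0, Finsupp.single b r) := by
  classical
  ext b <;> simp [Finsupp.single_apply]

theorem HasLinearResolution.of_retract {N N' : Type*} [AddCommGroup N] [Module R N]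
    [AddCommGroup N'] [Module R' N'] {L : Set R} {L' : Set R'} (hpi : ∀ r, p (i r) = r)
    (y : R') (hpy : p y = 0) (hdecomp : ∀ r, ∃ s, r = i (p r) + y * s)
    (hy : ∀ s, y * s = 0 → s = 0) (f : N ≃+ N')
    (hf : ∀ (r : R') (x : N), f (p r • x) = r • f x) (hL : ∀ r ∈ L, i r ∈ L')
    (hnegL : ∀ r ∈ L, -i r ∈ L') (hyL : y ∈ L') (h0L : (0 : R') ∈ L')
    (H : HasLinearResolution R L N) : HasLinearResolution R' L' N' := by
  obtain ⟨κ, d, ε, hε, h0, hs, hd⟩ := H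
  have hvec : ∀ (α : Type) (v : α →₀ R'), ∃ u, v = mapVec i α (mapVec p α v) + y • u := by
    intro α v
    classical
    choose s hs using hdecomp
    refine ⟨Finsupp.onFinset v.support (fun a => if v a = 0 then 0 else s (v a)) ?_, ?_⟩
    · intro a ha
      by_contra h
      exact ha (if_pos (by simpa using h))
    · ext a
      by_cases h : v a = 0
      · simp [h]
      · simpa [h] using hs (v a)
  have hvy : ∀ (α : Type) (v : α →₀ R'), y • v = 0 → v = 0 := by
    intro α v h
    ext a
    exact hy _ (by simpa using DFunLike.congr_fun h a)
  have hpy' : ∀ (α : Type) (v : α →₀ R'), mapVec p α (y • v) = 0 := by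
    intro α v
    rw [mapVec_smul, hpy, zero_smul]
  have hdd : ∀ l v, d l (d (l + 1) v) = 0 := by
    intro l v
    have : d (l + 1) v ∈ LinearMap.ker (d l) := hs l ▸ ⟨_, rfl⟩
    exact this
  have hcyc : ∀ (l : ℕ) (u : κ (l + 1) →₀ R') (v : κ l →₀ R'),
      mapMatrix i (d l) u + y • v = 0 →
      ∃ (u' : κ (l + 2) →₀ R') (v' : κ (l + 1) →₀ R'),
        mapMatrix i (d (l + 1)) u' + y • v' = u ∧ -mapMatrix i (d l) v' = v := by
    intro l u v huv
    have h1 : mapVec p _ u ∈ LinearMap.ker (d l) := by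
      have := congrArg (mapVec p _) huv
      rw [map_add, hpy', add_zero, mapVec_mapMatrix i p hpi, map_zero] at this
      exact this
    rw [← hs] at h1
    obtain ⟨w, hw⟩ := h1
    obtain ⟨v', hv'⟩ := hvec _ u
    refine ⟨mapVec i _ w, v', ?_, ?_⟩
    · rw [mapMatrix_mapVec, hw, ← hv']
    · have : y • (v + mapMatrix i (d l) v') = 0 := by
        rw [hv', ← hw, map_add, mapMatrix_mapVec, hdd, map_zero, zero_add, map_smul] at huv
        rw [smul_add, add_comm]
        exact huv
      rw [neg_eq_iff_add_eq_zero, add_comm]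
      exact hvy _ _ this
  let E (l : ℕ) := Finsupp.sumFinsuppLEquivProdFinsupp R' (M := R') (α := κ (l + 1)) (β := κ l)
  let ε' : (κ 0 →₀ R') →ₗ[R'] N' :=
    { toFun := fun v => f (ε (mapVec p _ v))
      map_add' := fun u v => by simp only [map_add]
      map_smul' := fun r v => by rw [mapVec_smul, map_smul, hf]; simp }
  have hε' : ∀ v, ε' v = f (ε (mapVec p _ v)) := fun _ => rfl
  have c0 : ∀ u, coneDiff i y d 0 u = mapMatrix i (d 0) (E 0 u).1 + y • (E 0 u).2 := fun _ => rfl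
  have c1 : ∀ l u, E l (coneDiff i y d (l + 1) u) =
      (mapMatrix i (d (l + 1)) (E (l + 1) u).1 + y • (E (l + 1) u).2,
        -mapMatrix i (d l) (E (l + 1) u).2) := by
    intro l u
    simp [coneDiff, E]
  have hcyc' : ∀ (l : ℕ) (x : κ (l + 1) ⊕ κ l →₀ R'),
      mapMatrix i (d l) (E l x).1 + y • (E l x).2 = 0 →
        x ∈ LinearMap.range (coneDiff i y d (l + 1)) := by
    intro l x hx
    obtain ⟨u', v', h1, h2⟩ := hcyc l _ _ hx
    refine ⟨(E (l + 1)).symm (u', v'), (E l).injective ?_⟩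
    rw [c1, LinearEquiv.apply_symm_apply, h1, h2]
  have hbd : ∀ (l : ℕ) (u : κ (l + 2) →₀ R') (v : κ (l + 1) →₀ R'),
      mapMatrix i (d l) (mapMatrix i (d (l + 1)) u + y • v) + y • -mapMatrix i (d l) v = 0 := by
    intro l u v
    rw [map_add, mapMatrix_mapMatrix i _ _ (hdd l), map_smul, smul_neg, zero_add, add_neg_cancel]
  refine ⟨coneIndex κ, coneDiff i y d, ε', ?_, ?_, ?_, ?_⟩
  · intro x
    obtain ⟨v, hv⟩ := hε (f.symm x)
    refine ⟨mapVec i _ v, ?_⟩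
    rw [hε', mapVec_mapVec i p hpi, hv, f.apply_symm_apply]
  · ext v
    constructor
    · rintro ⟨w, rfl⟩
      rw [LinearMap.mem_ker, c0, hε', map_add, hpy', add_zero, mapVec_mapMatrix i p hpi]
      have : d 0 (mapVec p _ (E 0 w).1) ∈ LinearMap.ker ε := h0 ▸ ⟨_, rfl⟩
      rw [LinearMap.mem_ker.mp this, map_zero]
    · intro hv
      rw [LinearMap.mem_ker, hε', map_eq_zero_iff f f.injective, ← LinearMap.mem_ker, ← h0] at hv
      obtain ⟨w, hw⟩ := hv
      obtain ⟨u, hu⟩ := hvec _ v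
      refine ⟨(E 0).symm (mapVec i _ w, u), ?_⟩
      rw [c0, LinearEquiv.apply_symm_apply, mapMatrix_mapVec, hw, ← hu]
  · rintro (_ | l)
    · ext x
      constructor
      · rintro ⟨w, rfl⟩
        rw [LinearMap.mem_ker, c0, c1]
        exact hbd _ _ _
      · intro hx
        exact hcyc' 0 x hx
    · ext x
      constructor
      · rintro ⟨w, rfl⟩
        rw [LinearMap.mem_ker]
        apply (E l).injective
        rw [c1, c1, map_zero, hbd, map_neg, mapMatrix_mapMatrix i _ _ (hdd l), neg_zero, neg_zero]
        rfl
      · intro hx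
        refine hcyc' (l + 1) x ?_
        have := congrArg (E l) (LinearMap.mem_ker.mp hx)
        rw [c1, map_zero] at this
        exact congrArg Prod.fst this
  · rintro (_ | l) (a | a) b
    · rw [c0]
      simp only [E, sumEquiv_single_inl, mapMatrix_single]
      simpa using hL _ (hd 0 a b)
    · rw [c0]
      simp only [E, sumEquiv_single_inr]
      classical
      simp only [map_zero, zero_add, Finsupp.smul_single, smul_eq_mul, mul_one,
        Finsupp.single_apply]
      split_ifs <;> assumption
    · have h1 := c1 l (Finsupp.single (Sum.inl a) 1)
      simp only [E, sumEquiv_single_inl, mapMatrix_single] at h1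
      rcases b with b | b
      · have := DFunLike.congr_fun (congrArg Prod.fst h1) b
        rw [Finsupp.fst_sumFinsuppLEquivProdFinsupp] at this
        rw [this]
        simpa using hL _ (hd _ a b)
      · have := DFunLike.congr_fun (congrArg Prod.snd h1) b
        rw [Finsupp.snd_sumFinsuppLEquivProdFinsupp] at this
        rw [this]
        simpa using h0L
    · have h1 := c1 l (Finsupp.single (Sum.inr a) 1)
      simp only [E, sumEquiv_single_inr, mapMatrix_single] at h1
      rcases b with b | b
      · have := DFunLike.congr_fun (congrArg Prod.fst h1) b
        rw [Finsupp.fst_sumFinsuppLEquivProdFinsupp] at this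
        rw [this]
        classical
        simp only [map_zero, zero_add, Finsupp.smul_single, smul_eq_mul, mul_one,
          Finsupp.single_apply]
        split_ifs <;> assumption
      · have := DFunLike.congr_fun (congrArg Prod.snd h1) b
        rw [Finsupp.snd_sumFinsuppLEquivProdFinsupp] at this
        rw [this]
        simpa using hnegL _ (hd _ a b)

end LinearResolution

section AssociatedGraded

variable (k : Type) [Field k]

/-- The ring homomorphism `S → Rees(m)` sending each variable `x_l` to `x_l t`. -/
def toRees (n : ℕ) : MvPolynomial (Fin n) k →+* ↥(reesAlgebra (maxIdeal k n)) :=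
  eval₂Hom ((algebraMap (MvPolynomial (Fin n) k) ↥(reesAlgebra (maxIdeal k n))).comp C) fun l =>
    ⟨Polynomial.monomial 1 (X l), reesAlgebra.monomial_mem.mpr (by
      rw [pow_one, maxIdeal]
      exact Ideal.subset_span (Set.mem_range_self l))⟩

/-- The canonical ring homomorphism from `S` to its associated graded ring. -/
def toGr (n : ℕ) : MvPolynomial (Fin n) k →+* GrRing k n :=
  (Ideal.Quotient.mk (grIdeal k n)).comp (toRees k n)

theorem toGr_X (n : ℕ) (l : Fin n) : toGr k n (X l) = grVar k n l := by
  simp [toGr, toRees, grVar]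

theorem toGr_C (n : ℕ) (c : k) : toGr k n (C c) =
    Ideal.Quotient.mk (grIdeal k n) (algebraMap (MvPolynomial (Fin n) k) _ (C c)) := by
  simp [toGr, toRees]

theorem coeff_toRees (n : ℕ) (q : MvPolynomial (Fin n) k) (i : ℕ) :
    (toRees k n q : Polynomial (MvPolynomial (Fin n) k)).coeff i =
      homogeneousComponent i q := by
  have key : ∀ (s : Fin n →₀ ℕ) (c : k),
      (toRees k n (monomial s c) : Polynomial (MvPolynomial (Fin n) k)) =
        Polynomial.monomial s.degree (monomial s c) := by
    intro s c
    induction s using Finsupp.induction_linear generalizing c with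
    | zero => simp [toRees, ← C_apply]
    | add f g hf hg =>
      have h : (monomial (f + g) c : MvPolynomial (Fin n) k) = monomial f c * monomial g 1 := by
        simp [monomial_mul]
      rw [h, map_mul, MulMemClass.coe_mul, hf, hg, Polynomial.monomial_mul_monomial, ← map_add]
    | single l m =>
      rw [← C_mul_X_pow_eq_monomial]
      simp [toRees, Polynomial.monomial_pow, Polynomial.C_mul_monomial]
  induction q using MvPolynomial.induction_on' with
  | monomial s c =>
    rw [key, Polynomial.coeff_monomial]
    split_ifs with h
    · rw [homogeneousComponent_of_mem (isHomogeneous_monomial c h), if_pos rfl]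
    · rw [homogeneousComponent_of_mem (isHomogeneous_monomial c rfl), if_neg (Ne.symm h)]
  | add p q hp hq => simp [hp, hq]

theorem coeff_mem_of_mem_grIdeal (n : ℕ) {f : ↥(reesAlgebra (maxIdeal k n))}
    (hf : f ∈ grIdeal k n) (i : ℕ) :
    (f : Polynomial (MvPolynomial (Fin n) k)).coeff i ∈ maxIdeal k n ^ (i + 1) := by
  rw [grIdeal, Ideal.map] at hf
  induction hf using Submodule.span_induction generalizing i with
  | mem x h =>
    obtain ⟨s, hs, rfl⟩ := h
    change (Polynomial.C s).coeff i ∈ _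
    rw [Polynomial.coeff_C]
    split_ifs with hi
    · subst hi
      simpa using hs
    · exact Ideal.zero_mem _
  | zero => simp
  | add x y _ _ hx hy => simpa using Ideal.add_mem _ (hx i) (hy i)
  | smul a x _ hx =>
    rw [smul_eq_mul, MulMemClass.coe_mul, Polynomial.coeff_mul]
    refine Ideal.sum_mem _ fun u hu => ?_
    rw [← Finset.HasAntidiagonal.mem_antidiagonal.mp hu, add_assoc, pow_add]
    exact Ideal.mul_mem_mul (a.2 _) (hx _)

theorem toGr_injective (n : ℕ) : Function.Injective (toGr k n) := by
  rw [injective_iff_map_eq_zero]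
  intro q hq
  have hq' : toRees k n q ∈ grIdeal k n := Ideal.Quotient.eq_zero_iff_mem.mp hq
  ext s
  have h := coeff_mem_of_mem_grIdeal k n hq' s.degree
  rw [coeff_toRees] at h
  have h2 := (mem_pow_idealOfVars_iff' _ _).mp h s (Nat.lt_succ_self _)
  rwa [coeff_homogeneousComponent, if_pos rfl] at h2

theorem toGr_surjective (n : ℕ) : Function.Surjective (toGr k n) := by
  have h0 : ∀ s : MvPolynomial (Fin n) k, Ideal.Quotient.mk (grIdeal k n)
      (algebraMap (MvPolynomial (Fin n) k) _ s) ∈ (toGr k n).range := by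
    intro s
    induction s using MvPolynomial.induction_on with
    | C c => exact ⟨C c, toGr_C k n c⟩
    | add p q hp hq => simpa only [map_add] using add_mem hp hq
    | mul_X p l hp =>
      have : Ideal.Quotient.mk (grIdeal k n) (algebraMap (MvPolynomial (Fin n) k) _ (X l)) = 0 :=
        Ideal.Quotient.eq_zero_iff_mem.mpr
          (Ideal.mem_map_of_mem _ (Ideal.subset_span (Set.mem_range_self l)))
      rw [map_mul, map_mul, this, mul_zero]
      exact zero_mem _
  have h1 : ∀ s (hs : s ∈ maxIdeal k n), Ideal.Quotient.mk (grIdeal k n)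
      ⟨Polynomial.monomial 1 s, reesAlgebra.monomial_mem.mpr (by simpa using hs)⟩ ∈
        (toGr k n).range := by
    intro s hs
    induction hs using Submodule.span_induction with
    | mem x h =>
      obtain ⟨l, rfl⟩ := h
      exact ⟨X l, toGr_X k n l⟩
    | zero =>
      convert zero_mem (toGr k n).range
      rw [Ideal.Quotient.eq_zero_iff_mem]
      convert zero_mem (grIdeal k n)
      ext1
      simp
    | add x y hx hy h h' =>
      convert add_mem h h'
      rw [← map_add]
      congr 1
      ext1
      simp
    | smul a x hx h =>
      convert mul_mem (h0 a) h
      rw [← map_mul]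
      congr 1
      ext1
      simp [Polynomial.C_mul_monomial, Polynomial.algebraMap_eq]
  intro g
  obtain ⟨⟨f, hf⟩, rfl⟩ := Ideal.Quotient.mk_surjective g
  change _ ∈ (toGr k n).range
  have hf' := hf
  rw [← adjoin_monomial_eq_reesAlgebra] at hf'
  induction hf' using Algebra.adjoin_induction with
  | mem x hx =>
    obtain ⟨s, hs, rfl⟩ := hx
    exact h1 s hs
  | algebraMap r => exact h0 r
  | add x y hx hy h h' =>
    rw [adjoin_monomial_eq_reesAlgebra] at hx hy
    exact add_mem (h hx) (h' hy)
  | mul x y hx hy h h' =>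
    rw [adjoin_monomial_eq_reesAlgebra] at hx hy
    exact mul_mem (h hx) (h' hy)

/-- The canonical isomorphism between `S` and its associated graded ring. -/
def grEquiv (n : ℕ) : MvPolynomial (Fin n) k ≃+* GrRing k n :=
  RingEquiv.ofBijective (toGr k n) ⟨toGr_injective k n, toGr_surjective k n⟩

variable {k}

theorem projToA_C (n j : ℕ) (c : k) : projToA k n j (C c) = C c := by
  simp [projToA, algebraMap_eq]

theorem projToA_X_of_lt {n j : ℕ} (l : Fin n) (h : (l : ℕ) < j) :
    projToA k n j (X l) = X ⟨l, h⟩ := by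
  simp [projToA, h]

theorem projToA_X_of_le {n j : ℕ} (l : Fin n) (h : j ≤ l) :
    projToA k n j (X l) = 0 := by
  simp [projToA, h.not_gt]

theorem inclA_C {n j : ℕ} (h : j ≤ n) (c : k) : inclA k n j h (C c) = C c := by
  simp [inclA]

theorem inclA_X {n j : ℕ} (h : j ≤ n) (l : Fin j) :
    inclA k n j h (X l) = X (Fin.castLE h l) := by
  simp [inclA]

theorem projToA_inclA {n j : ℕ} (h : j ≤ n) (q : MvPolynomial (Fin j) k) :
    projToA k n j (inclA k n j h q) = q := by
  have : (projToA k n j).comp (inclA k n j h) = RingHom.id _ := by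
    ext l
    · simp [inclA_C, projToA_C]
    · simp [inclA_X, projToA_X_of_lt (Fin.castLE h l) l.2]
  exact DFunLike.congr_fun this q

theorem projToA_projToA {n m j : ℕ} (h : j ≤ m) (q : MvPolynomial (Fin n) k) :
    projToA k m j (projToA k n m q) = projToA k n j q := by
  have : (projToA k m j).comp (projToA k n m) = projToA k n j := by
    apply MvPolynomial.ringHom_ext
    · simp [projToA_C]
    · intro l
      rw [RingHom.comp_apply]
      rcases lt_or_ge (l : ℕ) m with h1 | h1
      · rw [projToA_X_of_lt l h1]
        rcases lt_or_ge (l : ℕ) j with h2 | h2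
        · rw [projToA_X_of_lt l h2, projToA_X_of_lt _ (by exact h2)]
        · rw [projToA_X_of_le l h2, projToA_X_of_le _ (by exact h2)]
      · rw [projToA_X_of_le l h1, projToA_X_of_le l (h.trans h1), map_zero]
  exact DFunLike.congr_fun this q

theorem projToA_self (n : ℕ) (q : MvPolynomial (Fin n) k) : projToA k n n q = q := by
  have : projToA k n n = RingHom.id _ := by
    apply MvPolynomial.ringHom_ext
    · simp [projToA_C]
    · intro l
      simp [projToA_X_of_lt l l.2]
  exact DFunLike.congr_fun this q

theorem reesProj_reesIncl {n j : ℕ} (h : j ≤ n) (f : ↥(reesAlgebra (maxIdeal k j))) :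
    reesProj k n j (reesIncl k n j h f) = f := by
  ext1
  change ((f : Polynomial _).map (inclA k n j h)).map (projToA k n j) = f
  ext1 i
  simp [projToA_inclA]

theorem reesProj_mem_grIdeal {n j : ℕ} {f : ↥(reesAlgebra (maxIdeal k n))}
    (hf : f ∈ grIdeal k n) : reesProj k n j f ∈ grIdeal k j := by
  revert f
  change grIdeal k n ≤ (grIdeal k j).comap (reesProj k n j)
  rw [grIdeal, Ideal.map_le_iff_le_comap]
  intro x hx
  rw [Ideal.mem_comap, Ideal.mem_comap, reesProj_algebraMap]
  exact Ideal.mem_map_of_mem _ (projToA_maxIdeal_le k n j (Ideal.mem_map_of_mem _ hx))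

theorem reesIncl_mem_grIdeal {n j : ℕ} (h : j ≤ n) {f : ↥(reesAlgebra (maxIdeal k j))}
    (hf : f ∈ grIdeal k j) : reesIncl k n j h f ∈ grIdeal k n := by
  revert f
  change grIdeal k j ≤ (grIdeal k n).comap (reesIncl k n j h)
  rw [grIdeal, Ideal.map_le_iff_le_comap]
  intro x hx
  rw [Ideal.mem_comap, Ideal.mem_comap, reesIncl_algebraMap]
  exact Ideal.mem_map_of_mem _ (inclA_maxIdeal_le k n j h (Ideal.mem_map_of_mem _ hx))

theorem grProj_grEquiv {n j : ℕ} (q : MvPolynomial (Fin n) k) :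
    grProj k n j (grEquiv k n q) = grEquiv k j (projToA k n j q) := by
  have : (grProj k n j).comp (toGr k n) = (toGr k j).comp (projToA k n j) := by
    apply MvPolynomial.ringHom_ext
    · intro c
      rw [RingHom.comp_apply, RingHom.comp_apply, projToA_C, toGr_C, toGr_C, grProj,
        Ideal.quotientMap_mk, reesProj_algebraMap, projToA_C]
    · intro l
      rw [RingHom.comp_apply, RingHom.comp_apply, toGr_X, grVar, grProj, Ideal.quotientMap_mk]
      rcases lt_or_ge (l : ℕ) j with h | h
      · rw [projToA_X_of_lt l h, toGr_X, grVar]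
        congr 1
        ext1
        simp [reesProj, projToA_X_of_lt l h]
      · rw [projToA_X_of_le l h, map_zero, Ideal.Quotient.eq_zero_iff_mem]
        convert zero_mem (grIdeal k j)
        ext1
        simp [reesProj, projToA_X_of_le l h]
  exact DFunLike.congr_fun this q

theorem grIncl_grEquiv {n j : ℕ} (h : j ≤ n) (q : MvPolynomial (Fin j) k) :
    grIncl k n j h (grEquiv k j q) = grEquiv k n (inclA k n j h q) := by
  have : (grIncl k n j h).comp (toGr k j) = (toGr k n).comp (inclA k n j h) := by
    apply MvPolynomial.ringHom_ext
    · intro c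
      rw [RingHom.comp_apply, RingHom.comp_apply, inclA_C, toGr_C, toGr_C, grIncl,
        Ideal.quotientMap_mk, reesIncl_algebraMap, inclA_C]
    · intro l
      rw [RingHom.comp_apply, RingHom.comp_apply, toGr_X, grVar, grIncl, Ideal.quotientMap_mk,
        inclA_X, toGr_X, grVar]
      congr 1
      ext1
      simp [reesIncl, inclA_X]
  exact DFunLike.congr_fun this q

theorem grIncl_mem_grDeg1 {n j : ℕ} (h : j ≤ n) {g : GrRing k j} (hg : g ∈ grDeg1 k j) :
    grIncl k n j h g ∈ grDeg1 k n := by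
  obtain ⟨s, hs, rfl⟩ := hg
  refine ⟨inclA k n j h s, inclA_maxIdeal_le k n j h (Ideal.mem_map_of_mem _ hs), ?_⟩
  rw [grIncl, Ideal.quotientMap_mk]
  congr 1
  ext1
  simp [reesIncl]

theorem neg_mem_grDeg1 {n : ℕ} {g : GrRing k n} (hg : g ∈ grDeg1 k n) : -g ∈ grDeg1 k n := by
  obtain ⟨s, hs, rfl⟩ := hg
  refine ⟨-s, neg_mem hs, ?_⟩
  rw [← map_neg]
  congr 1
  ext1
  simp

theorem zero_mem_grDeg1 (n : ℕ) : (0 : GrRing k n) ∈ grDeg1 k n := by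
  refine ⟨0, zero_mem _, ?_⟩
  rw [← map_zero (Ideal.Quotient.mk (grIdeal k n))]
  congr 1
  ext1
  simp

theorem grVar_mem_grDeg1 {n : ℕ} (l : Fin n) : grVar k n l ∈ grDeg1 k n :=
  ⟨X l, Ideal.subset_span (Set.mem_range_self l), rfl⟩

theorem exists_eq_inclA_projToA_add (n : ℕ) (r : MvPolynomial (Fin (n + 1)) k) :
    ∃ s, r = inclA k (n + 1) n n.le_succ (projToA k (n + 1) n r) + X (Fin.last n) * s := by
  have : (Ideal.Quotient.mk (Ideal.span {(X (Fin.last n) : MvPolynomial (Fin (n + 1)) k)})).comp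
      ((inclA k (n + 1) n n.le_succ).comp (projToA k (n + 1) n)) = Ideal.Quotient.mk _ := by
    apply MvPolynomial.ringHom_ext
    · simp [projToA_C, inclA_C]
    · intro l
      induction l using Fin.lastCases with
      | last =>
        simp only [RingHom.comp_apply]
        rw [projToA_X_of_le _ (by simp), map_zero, map_zero, eq_comm,
          Ideal.Quotient.eq_zero_iff_mem]
        exact Ideal.subset_span rfl
      | cast l =>
        simp only [RingHom.comp_apply]
        rw [projToA_X_of_lt _ (by simp), inclA_X]
        rfl
  have h := DFunLike.congr_fun this r
  rw [RingHom.comp_apply, RingHom.comp_apply, eq_comm, Ideal.Quotient.eq,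
    Ideal.mem_span_singleton] at h
  obtain ⟨s, hs⟩ := h
  exact ⟨s, by rw [← hs]; ring⟩

theorem HasLinearResolution.compHom_projToA {j n : ℕ} (h : j ≤ n) {N : Type*} [AddCommGroup N]
    [Module (MvPolynomial (Fin j) k) N]
    (H : HasLinearResolution (MvPolynomial (Fin j) k) (grEquiv k j ⁻¹' grDeg1 k j) N) :
    letI : Module (MvPolynomial (Fin n) k) N := Module.compHom N (projToA k n j)
    HasLinearResolution (MvPolynomial (Fin n) k) (grEquiv k n ⁻¹' grDeg1 k n) N := by
  induction n, h using Nat.le_induction with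
  | base =>
    refine @HasLinearResolution.of_inverse _ _ _ _ (RingHom.id _) (RingHom.id _) N N _ _ _
      (Module.compHom N (projToA k j j)) _ _ (fun _ => rfl) (fun _ => rfl)
      (AddEquiv.refl N) (fun r x => ?_) (fun _ h => h) H
    change r • x = projToA k j j r • x
    rw [projToA_self]
  | succ n h ih =>
    let : Module (MvPolynomial (Fin n) k) N := Module.compHom N (projToA k n j)
    let : Module (MvPolynomial (Fin (n + 1)) k) N :=
      Module.compHom N (projToA k (n + 1) j)
    refine ih.of_retract (inclA k (n + 1) n n.le_succ) (projToA k (n + 1) n)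
      (projToA_inclA _) (X (Fin.last n)) (projToA_X_of_le _ (by simp))
      (exists_eq_inclA_projToA_add n) (fun s hs => ?_) (AddEquiv.refl N) (fun r x => ?_)
      (fun r hr => ?_) (fun r hr => ?_) ?_ ?_
    · exact (mul_eq_zero.mp hs).resolve_left (X_ne_zero _)
    · change projToA k n j (projToA k (n + 1) n r) • x =
        projToA k (n + 1) j r • x
      rw [projToA_projToA h]
    · rw [Set.mem_preimage, ← grIncl_grEquiv]
      exact grIncl_mem_grDeg1 _ hr
    · rw [Set.mem_preimage, map_neg, ← grIncl_grEquiv]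
      exact neg_mem_grDeg1 (grIncl_mem_grDeg1 _ hr)
    · change toGr k (n + 1) (X (Fin.last n)) ∈ grDeg1 k (n + 1)
      rw [toGr_X]
      exact grVar_mem_grDeg1 _
    · rw [Set.mem_preimage, map_zero]
      exact zero_mem_grDeg1 _

theorem HasLinearResolution.of_grProj {j n : ℕ} (h : j ≤ n) {N N' : Type*} [AddCommGroup N]
    [Module (GrRing k j) N] [AddCommGroup N'] [Module (GrRing k n) N'] (f : N' ≃+ N)
    (hf : ∀ (a : GrRing k n) (x : N'), f (a • x) = grProj k n j a • f x)
    (H : HasLinearResolution (GrRing k j) (grDeg1 k j) N) :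
    HasLinearResolution (GrRing k n) (grDeg1 k n) N' := by
  let _ : Module (MvPolynomial (Fin j) k) N := Module.compHom _ (grEquiv k j).toRingHom
  have H₁ : HasLinearResolution (MvPolynomial (Fin j) k) (grEquiv k j ⁻¹' grDeg1 k j) N := by
    refine H.of_inverse (grEquiv k j).symm.toRingHom (grEquiv k j).toRingHom
      (grEquiv k j).apply_symm_apply (grEquiv k j).symm_apply_apply (AddEquiv.refl _)
      (fun r x => ?_) (fun r hr => ?_)
    · change r • x = grEquiv k j ((grEquiv k j).symm r) • x
      rw [RingEquiv.apply_symm_apply]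
    · change grEquiv k j ((grEquiv k j).symm r) ∈ grDeg1 k j
      rwa [RingEquiv.apply_symm_apply]
  have H₂ := H₁.compHom_projToA h
  let _ : Module (MvPolynomial (Fin n) k) N := Module.compHom _ (projToA k n j)
  refine H₂.of_inverse (grEquiv k n).toRingHom (grEquiv k n).symm.toRingHom
    (grEquiv k n).symm_apply_apply (grEquiv k n).apply_symm_apply f.symm (fun r x => ?_)
    (fun r hr => hr)
  change f.symm (grEquiv k j (projToA k n j r) • x) = grEquiv k n r • f.symm x
  rw [AddEquiv.symm_apply_eq, hf, AddEquiv.apply_symm_apply, grProj_grEquiv]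

section ExtendedModule

variable {n j : ℕ} {C : Type} [AddCommGroup C] [Module (MvPolynomial (Fin j) k) C]
  [Module (MvPolynomial (Fin n) k) C]

theorem mem_pow_smul_top_iff (h : j ≤ n)
    (hC : ∀ (r : MvPolynomial (Fin n) k) (c : C), r • c = projToA k n j r • c) (i : ℕ) (c : C) :
    c ∈ maxIdeal k n ^ i • (⊤ : Submodule (MvPolynomial (Fin n) k) C) ↔
    c ∈ maxIdeal k j ^ i • (⊤ : Submodule (MvPolynomial (Fin j) k) C) := by
  have hp : (maxIdeal k n ^ i).map (projToA k n j) ≤ maxIdeal k j ^ i := by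
    rw [Ideal.map_pow]
    exact Ideal.pow_right_mono (projToA_maxIdeal_le k n j) i
  have hi : (maxIdeal k j ^ i).map (inclA k n j h) ≤ maxIdeal k n ^ i := by
    rw [Ideal.map_pow]
    exact Ideal.pow_right_mono (inclA_maxIdeal_le k n j h) i
  constructor
  · intro hc
    refine Submodule.smul_induction_on hc (fun r hr x _ => ?_) (fun x y hx hy => add_mem hx hy)
    rw [hC]
    exact Submodule.smul_mem_smul (hp (Ideal.mem_map_of_mem _ hr)) Submodule.mem_top
  · intro hc
    refine Submodule.smul_induction_on hc (fun r hr x _ => ?_) (fun x y hx hy => add_mem hx hy)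
    rw [← projToA_inclA h r, ← hC]
    exact Submodule.smul_mem_smul (hi (Ideal.mem_map_of_mem _ hr)) Submodule.mem_top

/-- The Rees modules of an `A`-module `C` and of the corresponding `S`-module coincide. -/
def reesModEquiv (h : j ≤ n)
    (hC : ∀ (r : MvPolynomial (Fin n) k) (c : C), r • c = projToA k n j r • c) :
    ReesMod k n C ≃+ ReesMod k j C where
  toFun f := ⟨.ofCoeff _ f.1.coeff, fun i => (mem_pow_smul_top_iff h hC i _).mp (f.2 i)⟩
  invFun f := ⟨.ofCoeff _ f.1.coeff, fun i => (mem_pow_smul_top_iff h hC i _).mpr (f.2 i)⟩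
  left_inv _ := rfl
  right_inv _ := rfl
  map_add' _ _ := rfl

theorem reesModEquiv_smul (h : j ≤ n)
    (hC : ∀ (r : MvPolynomial (Fin n) k) (c : C), r • c = projToA k n j r • c)
    (r : ↥(reesAlgebra (maxIdeal k n))) (f : ReesMod k n C) :
    reesModEquiv h hC (r • f) = reesProj k n j r • reesModEquiv h hC f := by
  apply Subtype.ext
  apply PolynomialModule.ext
  ext i
  change (r.1 • f.1).coeff i = ((reesProj k n j r).1 •
    (PolynomialModule.ofCoeff _ f.1.coeff : PolynomialModule _ C)).coeff i
  rw [PolynomialModule.smul_apply, PolynomialModule.smul_apply]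
  refine Finset.sum_congr rfl fun u _ => ?_
  rw [hC]
  congr 1
  simp [reesProj]

theorem reesModEquiv_mem_iff (h : j ≤ n)
    (hC : ∀ (r : MvPolynomial (Fin n) k) (c : C), r • c = projToA k n j r • c)
    (f : ReesMod k n C) :
    reesModEquiv h hC f ∈
      grIdeal k j • (⊤ : Submodule ↥(reesAlgebra (maxIdeal k j)) (ReesMod k j C)) ↔
    f ∈ grIdeal k n • (⊤ : Submodule ↥(reesAlgebra (maxIdeal k n)) (ReesMod k n C)) := by
  constructor
  · intro hf
    rw [← (reesModEquiv h hC).symm_apply_apply f]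
    refine Submodule.smul_induction_on hf (fun r hr x _ => ?_) (fun x y hx hy => ?_)
    · have : (reesModEquiv h hC).symm (r • x) =
          reesIncl k n j h r • (reesModEquiv h hC).symm x := by
        rw [AddEquiv.symm_apply_eq, reesModEquiv_smul, reesProj_reesIncl,
          AddEquiv.apply_symm_apply]
      rw [this]
      exact Submodule.smul_mem_smul (reesIncl_mem_grIdeal h hr) Submodule.mem_top
    · rw [map_add]
      exact add_mem hx hy
  · intro hf
    refine Submodule.smul_induction_on hf (fun r hr x _ => ?_) (fun x y hx hy => ?_)
    · rw [reesModEquiv_smul]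
      exact Submodule.smul_mem_smul (reesProj_mem_grIdeal hr) Submodule.mem_top
    · rw [map_add]
      exact add_mem hx hy

/-- The associated graded modules of an `A`-module `C` and of the corresponding `S`-module
are isomorphic as groups, compatibly with the projection of associated graded rings. -/
theorem exists_grMod_addEquiv (h : j ≤ n)
    (hC : ∀ (r : MvPolynomial (Fin n) k) (c : C), r • c = projToA k n j r • c) :
    ∃ f : GrMod k n C ≃+ GrMod k j C, ∀ (a : GrRing k n) (x : GrMod k n C),
      f (a • x) = grProj k n j a • f x := by
  let e : ReesMod k n C →ₛₗ[reesProj k n j] ReesMod k j C :=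
    { toFun := reesModEquiv h hC
      map_add' := map_add _
      map_smul' := reesModEquiv_smul h hC }
  let F := Submodule.mapQ
    (grIdeal k n • (⊤ : Submodule ↥(reesAlgebra (maxIdeal k n)) (ReesMod k n C)))
    (grIdeal k j • (⊤ : Submodule ↥(reesAlgebra (maxIdeal k j)) (ReesMod k j C))) e
    fun f hf => (reesModEquiv_mem_iff h hC f).mpr hf
  have hF : Function.Bijective F := by
    constructor
    · rw [injective_iff_map_eq_zero]
      intro x hx
      obtain ⟨x, rfl⟩ := Submodule.Quotient.mk_surjective _ x
      exact (Submodule.Quotient.mk_eq_zero _).mpr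
        ((reesModEquiv_mem_iff h hC x).mp ((Submodule.Quotient.mk_eq_zero _).mp hx))
    · intro x
      obtain ⟨x, rfl⟩ := Submodule.Quotient.mk_surjective _ x
      refine ⟨Submodule.Quotient.mk ((reesModEquiv h hC).symm x), ?_⟩
      change Submodule.Quotient.mk (reesModEquiv h hC ((reesModEquiv h hC).symm x)) = _
      rw [AddEquiv.apply_symm_apply]
  refine ⟨AddEquiv.ofBijective F.toAddMonoidHom hF, fun a x => ?_⟩
  obtain ⟨a, rfl⟩ := Ideal.Quotient.mk_surjective a
  obtain ⟨x, rfl⟩ := Submodule.Quotient.mk_surjective _ x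
  exact congrArg Submodule.Quotient.mk (reesModEquiv_smul h hC a x)

end ExtendedModule

end AssociatedGraded

/-- Let `C` be any `A`-module and `C_S` the corresponding `S`-module (via the surjection
`π : S → A`).  If `gr_n(C)` has a linear resolution over `gr_n(A)`, then `gr_m(C_S)` has
a linear resolution over `gr_m(S)`. -/
theorem linear_resolution_of_extended (k : Type) [Field k] (n j : ℕ) (hj : j < n)
    (C : Type) [AddCommGroup C] [Module (MvPolynomial (Fin j) k) C] :
    letI : Module (MvPolynomial (Fin n) k) C := Module.compHom C (projToA k n j)
    HasLinearResolution (GrRing k j) (grDeg1 k j) (GrMod k j C) →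
    HasLinearResolution (GrRing k n) (grDeg1 k n) (GrMod k n C) := by
  let _ : Module (MvPolynomial (Fin n) k) C := Module.compHom C (projToA k n j)
  intro H
  obtain ⟨f, hf⟩ := exists_grMod_addEquiv (k := k) (C := C) hj.le fun _ _ => rfl
  exact H.of_grProj hj.le f hf
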